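/- arXiv:1304.3595 — 5 statements merged into one kernel-verified Lean document; each statement's English description precedes it below -/
import Mathlib

section
/- For every smooth function f : ℝ → ℝ and every smooth positive function a : ℝ → ℝ, the intertwining relation at the level of generators holds pointwise: a·(L f)' = L_a(a·f') − V_a·(a·f'). In other words, denoting ∇_a f := a f' and L_a^{V_a} := L_a − V_a, one has ∇_a (L f) = L_a^{V_a}(∇_a f). -/
/-- The Sturm–Liouville operator `L f = σ² f'' + b f'`. -/
noncomputable def Lop (σ b f : ℝ → ℝ) : ℝ → ℝ :=
  fun x => σ x ^ 2 * deriv (deriv f) x + b x * deriv f x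

/-- The drift `b_a = 2σσ' + b − 2σ² a'/a` of the dual operator `L_a`. -/
noncomputable def driftA (σ b a : ℝ → ℝ) : ℝ → ℝ :=
  fun x => 2 * σ x * deriv σ x + b x - 2 * σ x ^ 2 * deriv a x / a x

/-- The Feynman–Kac potential `V_a = L_a(a)/a − b'`. -/
noncomputable def potV (σ b a : ℝ → ℝ) : ℝ → ℝ :=
  fun x => Lop σ (driftA σ b a) a x / a x - deriv b x

theorem ContDiff.hasDerivAt_deriv {f : ℝ → ℝ} (hf : ContDiff ℝ (⊤ : ℕ∞) f) (x : ℝ) :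
    HasDerivAt f (deriv f x) x :=
  (hf.differentiable (by simp) x).hasDerivAt

/-- The derivative of a real smooth function is smooth. -/
theorem ContDiff.smooth_deriv {f : ℝ → ℝ} (hf : ContDiff ℝ (⊤ : ℕ∞) f) :
    ContDiff ℝ (⊤ : ℕ∞) (deriv f) :=
  (contDiff_infty_iff_deriv.mp hf).2

theorem hasDerivAt_Lop {σ b f : ℝ → ℝ} (hσ : ContDiff ℝ (⊤ : ℕ∞) σ)
    (hb : ContDiff ℝ (⊤ : ℕ∞) b) (hf : ContDiff ℝ (⊤ : ℕ∞) f) (x : ℝ) :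
    HasDerivAt (Lop σ b f)
      (2 * σ x * deriv σ x * deriv (deriv f) x + σ x ^ 2 * deriv (deriv (deriv f)) x
        + (deriv b x * deriv f x + b x * deriv (deriv f) x)) x := by
  have h := (((hσ.hasDerivAt_deriv x).pow 2).mul
    (hf.smooth_deriv.smooth_deriv.hasDerivAt_deriv x)).add
    ((hb.hasDerivAt_deriv x).mul (hf.smooth_deriv.hasDerivAt_deriv x))
  refine h.congr_deriv ?_
  simp

/-- Leibniz rule for `L`: `L (g h) = h L g + g L h + 2 σ² g' h'`. -/
theorem Lop_mul (σ b : ℝ → ℝ) {g h : ℝ → ℝ} (hg : ContDiff ℝ (⊤ : ℕ∞) g)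
    (hh : ContDiff ℝ (⊤ : ℕ∞) h) (x : ℝ) :
    Lop σ b (fun y => g y * h y) x
      = h x * Lop σ b g x + g x * Lop σ b h x + 2 * σ x ^ 2 * deriv g x * deriv h x := by
  have h₁ : deriv (fun y => g y * h y) = fun y => deriv g y * h y + g y * deriv h y :=
    funext fun y => ((hg.hasDerivAt_deriv y).mul (hh.hasDerivAt_deriv y)).deriv
  have h₂ : deriv (fun y => deriv g y * h y + g y * deriv h y) x
      = deriv (deriv g) x * h x + deriv g x * deriv h x
        + (deriv g x * deriv h x + g x * deriv (deriv h) x) :=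
    (((hg.smooth_deriv.hasDerivAt_deriv x).mul (hh.hasDerivAt_deriv x)).add
      ((hg.hasDerivAt_deriv x).mul (hh.smooth_deriv.hasDerivAt_deriv x))).deriv
  simp only [Lop, h₁, h₂]
  ring

/-- Intertwining relation at the level of generators:
`∇_a (L f) = L_a(∇_a f) − V_a · ∇_a f` where `∇_a f = a f'`. -/
theorem generator_intertwining
    (σ b a f : ℝ → ℝ)
    (hσ : ContDiff ℝ (⊤ : ℕ∞) σ) (hb : ContDiff ℝ (⊤ : ℕ∞) b)
    (ha : ContDiff ℝ (⊤ : ℕ∞) a) (hf : ContDiff ℝ (⊤ : ℕ∞) f)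
    (hσpos : ∀ x, 0 < σ x) (hapos : ∀ x, 0 < a x) :
    ∀ x : ℝ,
      a x * deriv (Lop σ b f) x
        = Lop σ (driftA σ b a) (fun y => a y * deriv f y) x
            - potV σ b a x * (a x * deriv f x) := by
  intro x
  have hax : a x ≠ 0 := (hapos x).ne'
  rw [(hasDerivAt_Lop hσ hb hf x).deriv, Lop_mul _ _ ha hf.smooth_deriv]
  simp only [potV, Lop, driftA]
  field_simp
  ring
end

section
/- Let g : ℝ → ℝ be smooth with g'(x) > 0 for all x, and let a := 1/g'. Then the Feynman–Kac potential V_a admits the simple expression V_a = −(L g)'/g' pointwise on ℝ. -/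
/-- `(1/p)' = -p'/p²` wherever `p` is differentiable and nowhere zero. -/
theorem deriv_one_div_eq {p : ℝ → ℝ} (hp : Differentiable ℝ p) (hp0 : ∀ x, p x ≠ 0) :
    deriv (fun y => 1 / p y) = fun x => -deriv p x / p x ^ 2 := by
  funext x
  simpa using ((hp x).hasDerivAt.fun_inv (hp0 x)).deriv

/-- If `g` is smooth with `g' > 0` and `a := 1/g'`, then `V_a = −(L g)'/g'`. -/
theorem potV_of_inv_deriv
    (σ b g : ℝ → ℝ)
    (hσ : ContDiff ℝ (⊤ : ℕ∞) σ) (hb : ContDiff ℝ (⊤ : ℕ∞) b) (hg : ContDiff ℝ (⊤ : ℕ∞) g)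
    (hσpos : ∀ x, 0 < σ x) (hg' : ∀ x, 0 < deriv g x) :
    ∀ x : ℝ,
      potV σ b (fun y => 1 / deriv g y) x = - deriv (Lop σ b g) x / deriv g x := by
  have hp : ContDiff ℝ (⊤ : ℕ∞) (deriv g) := (contDiff_infty_iff_deriv.1 hg).2
  have hp' : ContDiff ℝ (⊤ : ℕ∞) (deriv (deriv g)) := (contDiff_infty_iff_deriv.1 hp).2
  have hg0 : ∀ x, deriv g x ≠ 0 := fun x => (hg' x).ne'
  intro x
  have dσ := (hσ.differentiable (by simp) x).hasDerivAt
  have db := (hb.differentiable (by simp) x).hasDerivAt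
  have dp := (hp.differentiable (by simp) x).hasDerivAt
  have dp' := (hp'.differentiable (by simp) x).hasDerivAt
  have hL : deriv (Lop σ b g) x = _ := (((dσ.fun_pow 2).fun_mul dp').fun_add (db.fun_mul dp)).deriv
  have ha := deriv_one_div_eq (hp.differentiable (by simp)) hg0
  have ha' := (dp'.fun_neg.fun_div (dp.fun_pow 2) (pow_ne_zero 2 (hg0 x))).deriv
  rw [hL, potV, Lop, driftA, ha, ha']
  have := hg0 x
  field_simp
  push_cast
  ring
end

section
/- (Chen–Wang variational lower bound for the spectral gap.) Suppose there exist a smooth positive function a : ℝ → ℝ and a constant ρ > 0 such that V_a(x) ≥ ρ for all x ∈ ℝ. Then the Poincaré inequality holds: for every smooth compactly supported f : ℝ → ℝ, ρ · Var_μ(f) ≤ ∫_ℝ σ(x)² f'(x)² dμ(x). In particular the spectral gap λ₁ = inf{ ∫σ²(f')²dμ / Var_μ(f) } over nonconstant smooth compactly supported f satisfies λ₁ ≥ ρ. -/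
open MeasureTheory

/-- The potential `U(x) = U(0) − ∫_0^x b/σ²`. -/
noncomputable def Upot (σ b : ℝ → ℝ) (U0 : ℝ) : ℝ → ℝ :=
  fun x => U0 - ∫ u in (0:ℝ)..x, b u / σ u ^ 2

/-- The reversible measure `μ` with density `e^{−U}/σ²` w.r.t. Lebesgue measure. -/
noncomputable def muMeas (σ b : ℝ → ℝ) (U0 : ℝ) : Measure ℝ :=
  volume.withDensity (fun x => ENNReal.ofReal (Real.exp (-(Upot σ b U0 x)) / σ x ^ 2))

/-- The variance `Var_μ(f) = ∫ f² dμ − (∫ f dμ)²`. -/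
noncomputable def varMu (μ : Measure ℝ) (f : ℝ → ℝ) : ℝ :=
  (∫ x, f x ^ 2 ∂μ) - (∫ x, f x ∂μ) ^ 2

open Filter Topology

/-- A weighted Poincaré inequality on a bounded interval, for the density `m` and the energy
weight `w`, given a solution `Q` of the Riccati equation `Q' = -V / w - m Q²` with `V ≥ ρ`. -/
theorem intervalIntegral_poincare_of_riccati {m w V Q f f' : ℝ → ℝ} {ρ r R : ℝ}
    (hm : Continuous m) (hw : Continuous w) (hf' : Continuous f')
    (hmpos : ∀ x, 0 < m x) (hwpos : ∀ x, 0 < w x)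
    (hf : ∀ x, HasDerivAt f (f' x) x)
    (hQ : ∀ x, HasDerivAt Q (-V x / w x - m x * Q x ^ 2) x)
    (hρ : 0 < ρ) (hV : ∀ x, ρ ≤ V x) (hrR : r < R) :
    ρ * ((∫ x in r..R, f x ^ 2 * m x) - (∫ x in r..R, f x * m x) ^ 2 / ∫ x in r..R, m x)
      ≤ ∫ x in r..R, f' x ^ 2 * w x := by
  have hfc : Continuous f := continuous_iff_continuousAt.2 fun x => (hf x).continuousAt
  have hM : 0 < ∫ x in r..R, m x :=
    intervalIntegral.intervalIntegral_pos_of_pos (hm.intervalIntegrable _ _) hmpos hrR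
  set M := ∫ x in r..R, m x with hMdef
  set A := ∫ x in r..R, f x * m x with hA
  set c := A / M with hc
  set F : ℝ → ℝ := fun t => ∫ x in r..t, (f x - c) * m x with hF
  have hkm : Continuous fun x => (f x - c) * m x := by fun_prop
  have hFd : ∀ x, HasDerivAt F ((f x - c) * m x) x := fun x =>
    intervalIntegral.integral_hasDerivAt_right (hkm.intervalIntegrable _ _)
      (hkm.stronglyMeasurableAtFilter _ _) hkm.continuousAt
  have he : Continuous fun x => f' x ^ 2 * w x - ρ * ((f x - c) ^ 2 * m x) := by fun_prop
  set E : ℝ → ℝ := fun t => ∫ x in r..t, (f' x ^ 2 * w x - ρ * ((f x - c) ^ 2 * m x)) with hE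
  have hEd : ∀ x, HasDerivAt E (f' x ^ 2 * w x - ρ * ((f x - c) ^ 2 * m x)) x := fun x =>
    intervalIntegral.integral_hasDerivAt_right (he.intervalIntegrable _ _)
      (he.stronglyMeasurableAtFilter _ _) he.continuousAt
  have hΨ : Monotone fun t => E t - ρ * (F t ^ 2 * Q t - 2 * ((f t - c) * F t)) := by
    refine monotone_of_hasDerivAt_nonneg (fun x => (hEd x).sub
      (((((hFd x).pow 2).mul (hQ x)).sub
        ((((hf x).sub_const c).mul (hFd x)).const_mul 2)).const_mul ρ)) fun x => ?_
    have hw0 := hwpos x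
    have hid : f' x ^ 2 * w x - ρ * ((f x - c) ^ 2 * m x)
        - ρ * (2 * F x * ((f x - c) * m x) * Q x
          + F x ^ 2 * (-V x / w x - m x * Q x ^ 2)
          - 2 * (f' x * F x + (f x - c) * ((f x - c) * m x)))
        = ρ * m x * (f x - c - F x * Q x) ^ 2 + w x * (f' x + ρ * F x / w x) ^ 2
          + ρ * F x ^ 2 * (V x - ρ) / w x := by
      field_simp
      ring
    have h1 : 0 ≤ V x - ρ := sub_nonneg.2 (hV x)
    have h2 := hmpos x
    have : 0 ≤ ρ * m x * (f x - c - F x * Q x) ^ 2 + w x * (f' x + ρ * F x / w x) ^ 2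
          + ρ * F x ^ 2 * (V x - ρ) / w x := by positivity
    rw [← hid] at this
    simpa using this
  have hFr : F r = 0 := by simp [hF]
  have hint1 : IntervalIntegrable (fun x => f x * m x) volume r R :=
    (hfc.mul hm).intervalIntegrable _ _
  have hint2 : IntervalIntegrable (fun x => f x ^ 2 * m x) volume r R :=
    ((hfc.pow 2).mul hm).intervalIntegrable _ _
  have hint3 : IntervalIntegrable m volume r R := hm.intervalIntegrable _ _
  have hint4 : IntervalIntegrable (fun x => f' x ^ 2 * w x) volume r R :=
    ((hf'.pow 2).mul hw).intervalIntegrable _ _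
  have hFR : F R = 0 := by
    have : F R = A - c * M := by
      simp only [hF, sub_mul]
      rw [intervalIntegral.integral_sub hint1 (hint3.const_mul c),
        intervalIntegral.integral_const_mul]
    rw [this, hc]
    field_simp
    ring
  have hEr : E r = 0 := by simp [hE]
  have hER : E R = (∫ x in r..R, f' x ^ 2 * w x)
      - ρ * ((∫ x in r..R, f x ^ 2 * m x) - A ^ 2 / M) := by
    have hexp : ∀ x, f' x ^ 2 * w x - ρ * ((f x - c) ^ 2 * m x)
        = f' x ^ 2 * w x
          - ρ * (f x ^ 2 * m x - (2 * c) * (f x * m x) + c ^ 2 * m x) := fun x => by ring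
    simp only [hE, hexp]
    rw [intervalIntegral.integral_sub hint4
        (((hint2.sub (hint1.const_mul _)).add (hint3.const_mul _)).const_mul ρ),
      intervalIntegral.integral_const_mul,
      intervalIntegral.integral_add (hint2.sub (hint1.const_mul _)) (hint3.const_mul _),
      intervalIntegral.integral_sub hint2 (hint1.const_mul _),
      intervalIntegral.integral_const_mul, intervalIntegral.integral_const_mul,
      ← hA, ← hMdef, hc]
    field_simp
    ring
  have hmono := hΨ hrR.le
  simp only [hFr, hFR, hEr, hER] at hmono
  linarith

/-- `(σ² g' + b g) / (w g)` with `g = 1 / a` and `w' = b w / σ²` solves the Riccati equation with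
potential `V_a`. -/
theorem hasDerivAt_riccati_potV {σ b a w : ℝ → ℝ} (hσ : Differentiable ℝ σ)
    (hb : Differentiable ℝ b) (ha : Differentiable ℝ a) (ha' : Differentiable ℝ (deriv a))
    (hσpos : ∀ x, 0 < σ x) (hapos : ∀ x, 0 < a x) (hwpos : ∀ x, 0 < w x)
    (hw : ∀ x, HasDerivAt w (b x * (w x / σ x ^ 2)) x) (x : ℝ) :
    HasDerivAt (fun x => (b x - σ x ^ 2 * deriv a x / a x) / w x)
      (-potV σ b a x / w x
        - w x / σ x ^ 2 * ((b x - σ x ^ 2 * deriv a x / a x) / w x) ^ 2) x := by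
  have h1 := hσpos x
  have h2 := hapos x
  have h3 := hwpos x
  have hd := ((hb x).hasDerivAt.sub ((((hσ x).hasDerivAt.pow 2).mul
    (ha' x).hasDerivAt).div (ha x).hasDerivAt h2.ne')).div (hw x) h3.ne'
  refine hd.congr_deriv ?_
  simp only [potV, Lop, driftA, Pi.pow_apply, Pi.mul_apply, Pi.sub_apply, Pi.div_apply]
  field_simp
  ring

theorem hasDerivAt_exp_neg_Upot {σ b : ℝ → ℝ} (hσ : Continuous σ) (hb : Continuous b)
    (hσpos : ∀ x, 0 < σ x) (U0 x : ℝ) :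
    HasDerivAt (fun x => Real.exp (-Upot σ b U0 x))
      (b x * (Real.exp (-Upot σ b U0 x) / σ x ^ 2)) x := by
  have hc : Continuous fun u => b u / σ u ^ 2 :=
    hb.div (hσ.pow 2) fun u => (pow_pos (hσpos u) 2).ne'
  have hd : HasDerivAt (Upot σ b U0) (-(b x / σ x ^ 2)) x :=
    (intervalIntegral.integral_hasDerivAt_right (hc.intervalIntegrable 0 x)
      (hc.stronglyMeasurableAtFilter _ _) hc.continuousAt).const_sub U0
  refine hd.neg.exp.congr_deriv ?_
  simp only [Pi.neg_apply]
  ring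

/-- Chen–Wang variational lower bound for the spectral gap: if `V_a ≥ ρ > 0` for some
smooth positive `a`, then the Poincaré inequality `ρ Var_μ(f) ≤ ∫ σ² (f')² dμ` holds. -/
theorem chen_wang_spectral_gap
    (σ b a : ℝ → ℝ) (U0 ρ : ℝ)
    (hσ : ContDiff ℝ (⊤ : ℕ∞) σ) (hb : ContDiff ℝ (⊤ : ℕ∞) b) (ha : ContDiff ℝ (⊤ : ℕ∞) a)
    (hσpos : ∀ x, 0 < σ x) (hapos : ∀ x, 0 < a x)
    (hcomp₁ : ∫⁻ u in Set.Ioi (0:ℝ), ENNReal.ofReal (1 / σ u) = ⊤)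
    (hcomp₂ : ∫⁻ u in Set.Iio (0:ℝ), ENNReal.ofReal (1 / σ u) = ⊤)
    (hprob : IsProbabilityMeasure (muMeas σ b U0))
    (hρ : 0 < ρ) (hVa : ∀ x, ρ ≤ potV σ b a x) :
    ∀ f : ℝ → ℝ, ContDiff ℝ (⊤ : ℕ∞) f → HasCompactSupport f →
      ρ * varMu (muMeas σ b U0) f
        ≤ ∫ x, σ x ^ 2 * deriv f x ^ 2 ∂(muMeas σ b U0) := by
  intro f hf hfs
  set w : ℝ → ℝ := fun x => Real.exp (-Upot σ b U0 x) with hw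
  set m : ℝ → ℝ := fun x => w x / σ x ^ 2 with hm
  have hwd : ∀ x, HasDerivAt w (b x * m x) x :=
    hasDerivAt_exp_neg_Upot hσ.continuous hb.continuous hσpos U0
  have hwc : Continuous w := continuous_iff_continuousAt.2 fun x => (hwd x).continuousAt
  have hwpos : ∀ x, 0 < w x := fun x => Real.exp_pos _
  have hmc : Continuous m :=
    hwc.div (hσ.continuous.pow 2) fun x => (pow_pos (hσpos x) 2).ne'
  have hmpos : ∀ x, 0 < m x := fun x => div_pos (hwpos x) (pow_pos (hσpos x) 2)
  have integral_mu : ∀ φ : ℝ → ℝ, ∫ x, φ x ∂(muMeas σ b U0) = ∫ x, φ x * m x := fun φ => by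
    rw [muMeas, integral_withDensity_eq_integral_toReal_smul
      hmc.measurable.ennreal_ofReal (ae_of_all _ fun x => ENNReal.ofReal_lt_top)]
    refine integral_congr_ae (ae_of_all _ fun x => ?_)
    simp only [smul_eq_mul]
    rw [ENNReal.toReal_ofReal (hmpos x).le, mul_comm]
  have hm1 : ∫ x, m x = 1 := by
    simpa using (integral_mu fun _ => 1).symm
  have hmi : Integrable m := by
    by_contra h
    rw [integral_undef h] at hm1
    exact zero_ne_one hm1
  have hf'c : Continuous (deriv f) := hf.continuous_deriv (by simp)
  have hfd : ∀ x, HasDerivAt f (deriv f x) x :=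
    fun x => (hf.differentiable (by simp) x).hasDerivAt
  have hi1 : Integrable fun x => f x * m x :=
    (hf.continuous.mul hmc).integrable_of_hasCompactSupport hfs.mul_right
  have hi2 : Integrable fun x => f x ^ 2 * m x := by
    have := (hf.continuous.mul (hf.continuous.mul hmc)).integrable_of_hasCompactSupport
      (μ := volume) (hfs.mul_right (f' := f * m))
    refine this.congr (ae_of_all _ fun x => ?_)
    simp only [Pi.mul_apply]
    ring
  have hi3 : Integrable fun x => deriv f x ^ 2 * w x := by
    have := (hf'c.mul (hf'c.mul hwc)).integrable_of_hasCompactSupport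
      (μ := volume) (hfs.deriv.mul_right (f' := deriv f * w))
    refine this.congr (ae_of_all _ fun x => ?_)
    simp only [Pi.mul_apply]
    ring
  have hQ := hasDerivAt_riccati_potV (hσ.differentiable (by simp)) (hb.differentiable (by simp))
    (ha.differentiable (by simp)) ((contDiff_infty_iff_deriv.1 ha).2.differentiable (by simp))
    hσpos hapos hwpos hwd
  have hlim : ∀ {φ : ℝ → ℝ}, Integrable φ →
      Tendsto (fun n : ℝ => ∫ x in (-n)..n, φ x) atTop (𝓝 (∫ x, φ x)) := fun hφ =>
    intervalIntegral_tendsto_integral hφ tendsto_neg_atTop_atBot tendsto_id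
  have hL := ((hlim hi2).sub (((hlim hi1).pow 2).div (hlim hmi)
    (by rw [hm1]; exact one_ne_zero))).const_mul ρ
  have key := le_of_tendsto_of_tendsto hL (hlim hi3) <| by
    filter_upwards [eventually_gt_atTop 0] with n hn
    exact intervalIntegral_poincare_of_riccati hmc hwc hf'c hmpos hwpos hfd hQ hρ hVa
      (by linarith)
  rw [hm1, div_one] at key
  rw [varMu, integral_mu, integral_mu, integral_mu]
  refine key.trans_eq (integral_congr_ae (ae_of_all _ fun x => ?_))
  have := (hσpos x).ne'
  simp only [hm]
  field_simp
end

section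
/- (Brascamp–Lieb type inequality.) Suppose there exist a smooth positive function a : ℝ → ℝ and a constant ρ > 0 such that V_a(x) ≥ ρ for all x ∈ ℝ. Then for every smooth compactly supported f : ℝ → ℝ, Var_μ(f) ≤ ∫_ℝ σ(x)² f'(x)² / V_a(x) dμ(x). -/
open MeasureTheory

/-- A weighted Poincaré inequality on an interval: if the Riccati equation `r' = -w - m r²` has a
solution, then the variance of `f` with respect to the weight `m` is controlled by
`∫ (f')² / w`. -/
theorem variance_le_of_riccati {m w r f f' : ℝ → ℝ} {s t : ℝ} (hst : s ≤ t)
    (hm : Continuous m) (hw : Continuous w) (hf' : Continuous f')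
    (hm0 : ∀ x, 0 ≤ m x) (hw0 : ∀ x, 0 < w x)
    (hr : ∀ x, HasDerivAt r (-w x - m x * r x ^ 2) x) (hf : ∀ x, HasDerivAt f (f' x) x)
    (hM : ∫ x in s..t, m x ≠ 0) :
    (∫ x in s..t, m x * f x ^ 2) - (∫ x in s..t, m x * f x) ^ 2 / (∫ x in s..t, m x)
      ≤ ∫ x in s..t, f' x ^ 2 / w x := by
  have hfc : Continuous f := continuous_iff_continuousAt.2 fun x => (hf x).continuousAt
  have hrc : Continuous r := continuous_iff_continuousAt.2 fun x => (hr x).continuousAt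
  have hwne : ∀ x, w x ≠ 0 := fun x => (hw0 x).ne'
  set M := ∫ x in s..t, m x with hMdef
  set S := ∫ x in s..t, m x * f x with hSdef
  set c := S / M with hc
  have hgc : Continuous fun x => (f x - c) * m x := by fun_prop
  set F : ℝ → ℝ := fun x => ∫ u in s..x, (f u - c) * m u with hFdef
  have hF : ∀ x, HasDerivAt F ((f x - c) * m x) x := fun x =>
    (hgc.integral_hasStrictDerivAt s x).hasDerivAt
  have hFc : Continuous F := continuous_iff_continuousAt.2 fun x => (hF x).continuousAt
  have hFs : F s = 0 := by simp [hFdef]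
  have hFt : F t = 0 := by
    have e : ∀ u, (f u - c) * m u = m u * f u - c * m u := fun u => by ring
    simp only [hFdef, e]
    have i1 : Continuous fun x => m x * f x := hm.mul hfc
    have i2 : Continuous fun x => c * m x := hm.const_mul c
    rw [intervalIntegral.integral_sub (i1.intervalIntegrable _ _)
      (i2.intervalIntegrable _ _), intervalIntegral.integral_const_mul, ← hMdef,
      ← hSdef, hc, div_mul_cancel₀ _ hM, sub_self]
  set K' : ℝ → ℝ := fun x => (f' x ^ 2 / w x - m x * (f x - c) ^ 2)
    - (w x * (F x + f' x / w x) ^ 2 + m x * (r x * F x - (f x - c)) ^ 2) with hK'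
  have hK : ∀ x, HasDerivAt (fun x => r x * F x ^ 2 - 2 * ((f x - c) * F x)) (K' x) x := by
    intro x
    have h1 := ((hr x).mul ((hF x).pow 2)).sub ((((hf x).sub_const c).mul (hF x)).const_mul 2)
    refine h1.congr_deriv ?_
    have := hwne x
    simp only [hK', Pi.pow_apply]
    field_simp
    ring
  have hK'c : Continuous K' := by fun_prop (disch := assumption)
  have int_eq : ∫ x in s..t, K' x = 0 := by
    rw [intervalIntegral.integral_eq_sub_of_hasDerivAt (fun x _ => hK x)
      (hK'c.intervalIntegrable _ _), hFs, hFt]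
    ring
  have hR : Continuous fun x => f' x ^ 2 / w x := by fun_prop (disch := assumption)
  have hV : Continuous fun x => m x * (f x - c) ^ 2 := by fun_prop
  have hle : ∫ x in s..t, K' x ≤ ∫ x in s..t, (f' x ^ 2 / w x - m x * (f x - c) ^ 2) := by
    refine intervalIntegral.integral_mono hst (hK'c.intervalIntegrable _ _)
      ((hR.sub hV).intervalIntegrable _ _) fun x => ?_
    have h1 := mul_nonneg (hw0 x).le (sq_nonneg (F x + f' x / w x))
    have h2 := mul_nonneg (hm0 x) (sq_nonneg (r x * F x - (f x - c)))
    simp only [hK']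
    linarith
  rw [int_eq, intervalIntegral.integral_sub (hR.intervalIntegrable _ _)
    (hV.intervalIntegrable _ _)] at hle
  have hexp : ∫ x in s..t, m x * (f x - c) ^ 2
      = (∫ x in s..t, m x * f x ^ 2) - S ^ 2 / M := by
    have e : ∀ x, m x * (f x - c) ^ 2 = m x * f x ^ 2 - (2 * c) * (m x * f x) + c ^ 2 * m x :=
      fun x => by ring
    have i1 : Continuous fun x => m x * f x ^ 2 := by fun_prop
    have i2 : Continuous fun x => 2 * c * (m x * f x) := by fun_prop
    have i3 : Continuous fun x => c ^ 2 * m x := by fun_prop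
    simp only [e]
    have i12 : Continuous fun x => m x * f x ^ 2 - 2 * c * (m x * f x) := i1.sub i2
    rw [intervalIntegral.integral_add (i12.intervalIntegrable _ _)
      (i3.intervalIntegrable _ _), intervalIntegral.integral_sub (i1.intervalIntegrable _ _)
      (i2.intervalIntegrable _ _), intervalIntegral.integral_const_mul,
      intervalIntegral.integral_const_mul, ← hMdef, ← hSdef, hc]
    field_simp
    ring
  linarith

/-- The global version of `variance_le_of_riccati`, for a probability density `m`. -/
theorem variance_le_of_riccati_of_integral_eq_one {m w r f f' : ℝ → ℝ}
    (hm : Continuous m) (hw : Continuous w) (hf' : Continuous f')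
    (hm0 : ∀ x, 0 ≤ m x) (hw0 : ∀ x, 0 < w x)
    (hr : ∀ x, HasDerivAt r (-w x - m x * r x ^ 2) x) (hf : ∀ x, HasDerivAt f (f' x) x)
    (hM : ∫ x, m x = 1) (hmi : Integrable m) (h1 : Integrable fun x => m x * f x)
    (h2 : Integrable fun x => m x * f x ^ 2) (h3 : Integrable fun x => f' x ^ 2 / w x) :
    (∫ x, m x * f x ^ 2) - (∫ x, m x * f x) ^ 2 ≤ ∫ x, f' x ^ 2 / w x := by
  have lim : ∀ {g : ℝ → ℝ}, Integrable g →
      Filter.Tendsto (fun T : ℝ => ∫ x in (-T)..T, g x) Filter.atTop (nhds (∫ x, g x)) :=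
    fun hg => intervalIntegral_tendsto_integral hg Filter.tendsto_neg_atTop_atBot
      Filter.tendsto_id
  have hlimM := lim hmi
  rw [hM] at hlimM
  have hlim := (lim h2).sub (((lim h1).pow 2).div hlimM one_ne_zero)
  rw [div_one] at hlim
  refine le_of_tendsto_of_tendsto hlim (lim h3) ?_
  filter_upwards [hlimM.eventually_ne one_ne_zero, Filter.eventually_ge_atTop 0] with T hT hT0
  exact variance_le_of_riccati (by linarith) hm hw hf' hm0 hw0 hr hf hT

/-- With `h' = h b / σ²`, the function `(b - σ² a' / a) / h` solves the Riccati equation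
`r' = -V_a / h - (h / σ²) r²`. -/
theorem hasDerivAt_riccati {σ b a h : ℝ → ℝ} {x : ℝ} (hσ : DifferentiableAt ℝ σ x)
    (hb : DifferentiableAt ℝ b x) (ha : DifferentiableAt ℝ a x)
    (ha' : DifferentiableAt ℝ (deriv a) x) (hh : HasDerivAt h (h x * (b x / σ x ^ 2)) x)
    (hσ0 : σ x ≠ 0) (ha0 : a x ≠ 0) (hh0 : h x ≠ 0) :
    HasDerivAt (fun x => (b x - σ x ^ 2 * (deriv a x / a x)) / h x)
      (-(potV σ b a x / h x)
        - h x / σ x ^ 2 * ((b x - σ x ^ 2 * (deriv a x / a x)) / h x) ^ 2) x := by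
  have h1 : HasDerivAt (fun x => (b x - σ x ^ 2 * (deriv a x / a x)) / h x) _ x :=
    (hb.hasDerivAt.fun_sub ((hσ.hasDerivAt.fun_pow 2).fun_mul
      (ha'.hasDerivAt.fun_div ha.hasDerivAt ha0))).fun_div hh hh0
  refine h1.congr_deriv ?_
  simp only [potV, Lop, driftA]
  generalize deriv (deriv a) x = a₂
  generalize deriv a x = a₁
  generalize deriv b x = b₁
  generalize deriv σ x = σ₁
  field_simp
  ring

/-- Brascamp–Lieb type inequality: if `V_a ≥ ρ > 0` for some smooth positive `a`, then
`Var_μ(f) ≤ ∫ σ² (f')² / V_a dμ`. -/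
theorem brascamp_lieb_type
    (σ b a : ℝ → ℝ) (U0 ρ : ℝ)
    (hσ : ContDiff ℝ (⊤ : ℕ∞) σ) (hb : ContDiff ℝ (⊤ : ℕ∞) b) (ha : ContDiff ℝ (⊤ : ℕ∞) a)
    (hσpos : ∀ x, 0 < σ x) (hapos : ∀ x, 0 < a x)
    (hcomp₁ : ∫⁻ u in Set.Ioi (0:ℝ), ENNReal.ofReal (1 / σ u) = ⊤)
    (hcomp₂ : ∫⁻ u in Set.Iio (0:ℝ), ENNReal.ofReal (1 / σ u) = ⊤)
    (hprob : IsProbabilityMeasure (muMeas σ b U0))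
    (hρ : 0 < ρ) (hVa : ∀ x, ρ ≤ potV σ b a x) :
    ∀ f : ℝ → ℝ, ContDiff ℝ (⊤ : ℕ∞) f → HasCompactSupport f →
      varMu (muMeas σ b U0) f
        ≤ ∫ x, σ x ^ 2 * deriv f x ^ 2 / potV σ b a x ∂(muMeas σ b U0) := by
  intro f hfs hfK
  have hσd : ∀ x, HasDerivAt σ (deriv σ x) x := fun x =>
    (hσ.differentiable (by simp) x).hasDerivAt
  have hbd : ∀ x, HasDerivAt b (deriv b x) x := fun x =>
    (hb.differentiable (by simp) x).hasDerivAt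
  have had : ∀ x, HasDerivAt a (deriv a x) x := fun x =>
    (ha.differentiable (by simp) x).hasDerivAt
  have hfd : ∀ x, HasDerivAt f (deriv f x) x := fun x =>
    (hfs.differentiable (by simp) x).hasDerivAt
  have ha' : ContDiff ℝ (⊤ : ℕ∞) (deriv a) := (contDiff_infty_iff_deriv.1 ha).2
  have had' : ∀ x, HasDerivAt (deriv a) (deriv (deriv a) x) x := fun x =>
    (ha'.differentiable (by simp) x).hasDerivAt
  have cσ := hσ.continuous
  have cb := hb.continuous
  have ca := ha.continuous
  have cσ' : Continuous (deriv σ) := hσ.continuous_deriv (by simp)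
  have cb' : Continuous (deriv b) := hb.continuous_deriv (by simp)
  have cf' : Continuous (deriv f) := hfs.continuous_deriv (by simp)
  have ca' := ha'.continuous
  have ca'' : Continuous (deriv (deriv a)) := ha'.continuous_deriv (by simp)
  have hσne : ∀ x, σ x ≠ 0 := fun x => (hσpos x).ne'
  have hσ2ne : ∀ x, σ x ^ 2 ≠ 0 := fun x => pow_ne_zero 2 (hσne x)
  have hane : ∀ x, a x ≠ 0 := fun x => (hapos x).ne'
  have cV : Continuous (potV σ b a) := by
    unfold potV Lop driftA
    fun_prop (disch := assumption)
  have hVpos : ∀ x, 0 < potV σ b a x := fun x => hρ.trans_le (hVa x)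
  set h : ℝ → ℝ := fun x => Real.exp (-(Upot σ b U0 x)) with hh
  have hhpos : ∀ x, 0 < h x := fun x => Real.exp_pos _
  have hhne : ∀ x, h x ≠ 0 := fun x => (hhpos x).ne'
  have hhd : ∀ x, HasDerivAt h (h x * (b x / σ x ^ 2)) x := by
    intro x
    have c : Continuous fun u => b u / σ u ^ 2 := by fun_prop (disch := assumption)
    have := (((c.integral_hasStrictDerivAt 0 x).hasDerivAt.const_sub U0).neg).exp
    rw [neg_neg] at this
    exact this
  have ch : Continuous h := continuous_iff_continuousAt.2 fun x => (hhd x).continuousAt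
  set m : ℝ → ℝ := fun x => h x / σ x ^ 2 with hmdef
  have cm : Continuous m := by fun_prop (disch := assumption)
  have hm0 : ∀ x, 0 ≤ m x := fun x => div_nonneg (hhpos x).le (sq_nonneg _)
  have hμ : muMeas σ b U0 = volume.withDensity fun x => ENNReal.ofReal (m x) := rfl
  have hlint : ∫⁻ x, ENNReal.ofReal (m x) = 1 := by
    have := hprob.measure_univ
    rwa [hμ, withDensity_apply _ MeasurableSet.univ, Measure.restrict_univ] at this
  have hmi : Integrable m := by
    refine ⟨cm.aestronglyMeasurable, ?_⟩
    rw [hasFiniteIntegral_iff_ofReal (Filter.Eventually.of_forall hm0), hlint]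
    exact ENNReal.one_lt_top
  have hM : ∫ x, m x = 1 := by
    rw [integral_eq_lintegral_of_nonneg_ae (Filter.Eventually.of_forall hm0)
      cm.aestronglyMeasurable, hlint, ENNReal.toReal_one]
  have int_eq : ∀ g : ℝ → ℝ, ∫ x, g x ∂(muMeas σ b U0) = ∫ x, m x * g x := by
    intro g
    rw [hμ, integral_withDensity_eq_integral_toReal_smul cm.measurable.ennreal_ofReal
      (Filter.Eventually.of_forall fun x => ENNReal.ofReal_lt_top)]
    simp only [ENNReal.toReal_ofReal (hm0 _), smul_eq_mul]
  set w : ℝ → ℝ := fun x => potV σ b a x / h x with hwdef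
  have cw : Continuous w := by fun_prop (disch := assumption)
  have hw0 : ∀ x, 0 < w x := fun x => div_pos (hVpos x) (hhpos x)
  have hwne : ∀ x, w x ≠ 0 := fun x => (hw0 x).ne'
  have hr := fun x => hasDerivAt_riccati (hσd x).differentiableAt (hbd x).differentiableAt
    (had x).differentiableAt (had' x).differentiableAt (hhd x) (hσne x) (hane x) (hhne x)
  have hf2K : HasCompactSupport fun x => f x ^ 2 :=
    hfK.comp_left (g := fun y : ℝ => y ^ 2) (by simp)
  have hdf2K : HasCompactSupport fun x => deriv f x ^ 2 :=
    hfK.deriv.comp_left (g := fun y : ℝ => y ^ 2) (by simp)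
  have i1 : Integrable fun x => m x * f x :=
    (cm.mul hfs.continuous).integrable_of_hasCompactSupport (hfK.mul_left (f := m))
  have i2 : Integrable fun x => m x * f x ^ 2 :=
    (cm.mul (hfs.continuous.pow 2)).integrable_of_hasCompactSupport (hf2K.mul_left (f := m))
  have i3 : Integrable fun x => deriv f x ^ 2 / w x := by
    simp only [div_eq_mul_inv]
    exact ((cf'.pow 2).mul (cw.inv₀ hwne)).integrable_of_hasCompactSupport
      (hdf2K.mul_right (f' := fun x => (w x)⁻¹))
  have key := variance_le_of_riccati_of_integral_eq_one cm cw cf' hm0 hw0 hr hfd hM hmi i1 i2 i3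
  have hrhs : ∫ x, deriv f x ^ 2 / w x
      = ∫ x, m x * (σ x ^ 2 * deriv f x ^ 2 / potV σ b a x) := by
    congr 1
    ext x
    have h1 := hhne x
    have h2 := hσne x
    have h3 := (hVpos x).ne'
    simp only [hwdef, hmdef]
    field_simp
  rw [varMu, int_eq, int_eq, int_eq, ← hrhs]
  exact key
end

section
/- (Log-Sobolev criterion.) Suppose there exist smooth positive functions a, ã : ℝ → ℝ, constants 0 < m ≤ M with m·σ ≤ a ≤ M·σ and m·σ ≤ ã ≤ M·σ, such that σ/a is increasing, σ/ã is decreasing, and constants ρ > 0, ρ̃ > 0 with V_a ≥ ρ and V_ã ≥ ρ̃ on ℝ. Then the logarithmic Sobolev inequality holds: for every smooth positive f : ℝ → (0,∞) with compactly supported derivative, 2·min(ρ, ρ̃) · Ent_μ(f) ≤ ∫_ℝ σ(x)² f'(x)²/f(x) dμ(x), where Ent_μ(f) := ∫ f log f dμ − (∫ f dμ)·log(∫ f dμ). -/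
open MeasureTheory

/-- If `A' = w B`, `S' = w > 0` and `B' ≤ -k w` between `x` and `t`, then `A`, viewed as a function
of `S`, lies below its second-order expansion at `x` with second derivative `-k`. -/
theorem sub_le_of_slope_deriv_le {A B B' S w : ℝ → ℝ} {k x t : ℝ}
    (hA : ∀ s, HasDerivAt A (w s * B s) s) (hB : ∀ s, HasDerivAt B (B' s) s)
    (hS : ∀ s, HasDerivAt S (w s) s) (hw : ∀ s, 0 < w s)
    (hB' : ∀ s ∈ Set.uIcc x t, B' s ≤ -(k * w s)) :
    A t - A x ≤ B x * (S t - S x) - k * (S t - S x) ^ 2 / 2 := by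
  set E : ℝ → ℝ := fun s => B s - B x + k * (S s - S x) with hE
  set D : ℝ → ℝ := fun s => A s - A x - B x * (S s - S x) + k * (S s - S x) ^ 2 / 2 with hD
  have hEd : ∀ s, HasDerivAt E (B' s + k * w s) s := fun s =>
    ((hB s).sub_const _).add (((hS s).sub_const _).const_mul k)
  have hDd : ∀ s, HasDerivAt D (w s * E s) s := fun s => by
    have h := (((hA s).sub_const (A x)).sub (((hS s).sub_const (S x)).const_mul (B x))).add
      (((((hS s).sub_const (S x)).pow 2).const_mul k).div_const 2)
    refine h.congr_deriv ?_
    simp only [hE]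
    push_cast
    ring
  have hEanti : AntitoneOn E (Set.uIcc x t) :=
    antitoneOn_of_deriv_nonpos (convex_uIcc x t)
      (fun s _ => (hEd s).continuousAt.continuousWithinAt)
      (fun s _ => (hEd s).differentiableAt.differentiableWithinAt)
      (fun s hs => by
        rw [(hEd s).deriv]
        linarith [hB' s (interior_subset hs)])
  have hEx : E x = 0 := by simp [hE]
  have hDx : D x = 0 := by simp [hD]
  suffices D t ≤ 0 by
    simp only [hD] at this
    linarith
  rcases le_total x t with hxt | htx
  · rw [Set.uIcc_of_le hxt] at hEanti
    have : AntitoneOn D (Set.Icc x t) :=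
      antitoneOn_of_deriv_nonpos (convex_Icc x t)
        (fun s _ => (hDd s).continuousAt.continuousWithinAt)
        (fun s _ => (hDd s).differentiableAt.differentiableWithinAt)
        (fun s hs => by
          have hs' := interior_subset hs
          rw [(hDd s).deriv]
          have := hEanti (Set.left_mem_Icc.2 hxt) hs' hs'.1
          exact mul_nonpos_of_nonneg_of_nonpos (hw s).le (by linarith))
    have := this (Set.left_mem_Icc.2 hxt) (Set.right_mem_Icc.2 hxt) hxt
    linarith
  · rw [Set.uIcc_of_ge htx] at hEanti
    have : MonotoneOn D (Set.Icc t x) :=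
      monotoneOn_of_deriv_nonneg (convex_Icc t x)
        (fun s _ => (hDd s).continuousAt.continuousWithinAt)
        (fun s _ => (hDd s).differentiableAt.differentiableWithinAt)
        (fun s hs => by
          have hs' := interior_subset hs
          rw [(hDd s).deriv]
          have := hEanti hs' (Set.right_mem_Icc.2 htx) hs'.2
          exact mul_nonneg (hw s).le (by linarith))
    have := this (Set.left_mem_Icc.2 htx) (Set.right_mem_Icc.2 htx) htx
    linarith

/-- The logarithmic slope `(σ² (1/a)' + b/a)` of `e^{-U}/a` has derivative `-V_a/a`. -/
theorem hasDerivAt_slope {σ b a : ℝ → ℝ} (hσ : ContDiff ℝ (⊤ : ℕ∞) σ)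
    (hb : ContDiff ℝ (⊤ : ℕ∞) b) (ha : ContDiff ℝ (⊤ : ℕ∞) a)
    (hapos : ∀ x, 0 < a x) (x : ℝ) :
    HasDerivAt (fun s => (b s - σ s ^ 2 * deriv a s / a s) / a s) (-(potV σ b a x / a x)) x := by
  have hσ' := (hσ.differentiable (by simp) x).hasDerivAt
  have hb' := (hb.differentiable (by simp) x).hasDerivAt
  have ha' := (ha.differentiable (by simp) x).hasDerivAt
  have ha'' : HasDerivAt (deriv a) (deriv (deriv a) x) x :=
    ((contDiff_infty_iff_deriv.1 ha).2.differentiable (by simp) x).hasDerivAt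
  have hne := (hapos x).ne'
  refine ((hb'.sub (((hσ'.pow 2).mul ha'').div ha' hne)).div ha' hne).congr_deriv ?_
  simp only [potV, Lop, driftA, Pi.pow_apply, Pi.mul_apply, Pi.sub_apply, Pi.div_apply]
  push_cast
  field_simp
  ring

/-- The flux `f (q/a) (S∘T - S)` attached to a weight `a` and to a map `T` transporting `f p` onto
`p`, where `p = q/σ²` and `S' = a/σ²`. -/
theorem flux_hasDerivAt_and_le {σ b a q f T S : ℝ → ℝ} {ρ κ T' x : ℝ}
    (hσ : ContDiff ℝ (⊤ : ℕ∞) σ) (hb : ContDiff ℝ (⊤ : ℕ∞) b) (ha : ContDiff ℝ (⊤ : ℕ∞) a)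
    (hσpos : ∀ x, 0 < σ x) (hapos : ∀ x, 0 < a x) (hqpos : ∀ x, 0 < q x)
    (hq : ∀ x, HasDerivAt q (b x / σ x ^ 2 * q x) x)
    (hS : ∀ x, HasDerivAt S (a x / σ x ^ 2) x)
    (hκρ : κ ≤ ρ) (hκ : 0 ≤ κ) (hVa : ∀ x, ρ ≤ potV σ b a x)
    (hf : DifferentiableAt ℝ f x) (hfpos : 0 < f x)
    (hT : HasDerivAt T T' x) (hT' : f x * (q x / σ x ^ 2) = T' * (q (T x) / σ (T x) ^ 2))
    (hmon : ∀ s ∈ Set.uIcc x (T x), σ x / a x ≤ σ s / a s) :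
    ∃ D, HasDerivAt (fun y => f y * (q y / a y) * (S (T y) - S y)) D x ∧
      (T x = x → D = f x * (q x / σ x ^ 2) * (T' - 1)) ∧
      f x * (q x / σ x ^ 2) * Real.log (f x)
        + deriv f x / f x * (f x * (q x / a x) * (S (T x) - S x))
        + κ / 2 * (f x * (q x / a x) * (S (T x) - S x)) ^ 2 / (f x * q x) ≤ D := by
  have hne := (hapos x).ne'
  have hqn := (hqpos x).ne'
  have hσn := (hσpos x).ne'
  have ha' := fun s => (ha.differentiable (by simp) s).hasDerivAt
  have hqa : HasDerivAt (fun y => q y / a y)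
      (a x / σ x ^ 2 * ((b x - σ x ^ 2 * deriv a x / a x) / a x) * (q x / a x)) x := by
    refine ((hq x).div (ha' x) hne).congr_deriv ?_
    field_simp
  have hST : HasDerivAt (fun y => S (T y) - S y)
      (a (T x) / σ (T x) ^ 2 * T' - a x / σ x ^ 2) x :=
    (HasDerivAt.comp x (hS (T x)) hT).sub (hS x)
  refine ⟨_, (hf.hasDerivAt.mul hqa).mul hST, ?_, ?_⟩
  · intro h
    simp only [h, sub_self, mul_zero, zero_add, Pi.mul_apply]
    field_simp
  · have hA : ∀ s, HasDerivAt (fun y => Real.log (q y / a y))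
        (a s / σ s ^ 2 * ((b s - σ s ^ 2 * deriv a s / a s) / a s)) s := fun s => by
      have h1 := (hapos s).ne'
      have h2 := (hqpos s).ne'
      have h3 := (hσpos s).ne'
      refine (((hq s).div (ha' s) h1).log (div_pos (hqpos s) (hapos s)).ne').congr_deriv ?_
      simp only [Pi.div_apply]
      field_simp
    have hw : ∀ s, 0 < a s / σ s ^ 2 := fun s => div_pos (hapos s) (pow_pos (hσpos s) 2)
    have key := sub_le_of_slope_deriv_le (x := x) (t := T x) (k := κ * (σ x / a x) ^ 2) hA
      (hasDerivAt_slope hσ hb ha hapos) hS hw (fun s hs => by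
        have h1 := hapos s
        have h3 := hσpos s
        have hsq : (σ x / a x) ^ 2 ≤ (σ s / a s) ^ 2 :=
          pow_le_pow_left₀ (div_pos (hσpos x) (hapos x)).le (hmon s hs) 2
        have : κ * (σ x / a x) ^ 2 * (a s / σ s ^ 2) ≤ potV σ b a s / a s := calc
          _ ≤ κ * (σ s / a s) ^ 2 * (a s / σ s ^ 2) := by gcongr
          _ = κ / a s := by field_simp
          _ ≤ _ := by
            gcongr
            exact hκρ.trans (hVa s)
        linarith)
    set β := S (T x) - S x
    have hpT : 0 < q (T x) / σ (T x) ^ 2 := div_pos (hqpos _) (pow_pos (hσpos _) 2)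
    have hpx : 0 < q x / σ x ^ 2 := div_pos (hqpos _) (pow_pos (hσpos _) 2)
    have hT'pos : 0 < T' := by
      have : 0 < T' * (q (T x) / σ (T x) ^ 2) := hT' ▸ mul_pos hfpos hpx
      exact pos_of_mul_pos_left this hpT.le
    have hqaT : 0 < q (T x) / a (T x) := div_pos (hqpos _) (hapos _)
    have hqax : 0 < q x / a x := div_pos (hqpos _) (hapos _)
    have hJ : 0 < T' * (a (T x) / σ (T x) ^ 2) / (a x / σ x ^ 2) :=
      div_pos (mul_pos hT'pos (hw _)) (hw x)
    have hfe : f x = T' * (a (T x) / σ (T x) ^ 2) / (a x / σ x ^ 2)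
        * ((q (T x) / a (T x)) / (q x / a x)) := by
      have h1 := (hapos (T x)).ne'
      have h2 := (hσpos (T x)).ne'
      rw [← mul_right_cancel_iff_of_pos hpx, hT']
      field_simp
    have hlog : Real.log (f x) ≤ T' * (a (T x) / σ (T x) ^ 2) / (a x / σ x ^ 2) - 1
        + ((b x - σ x ^ 2 * deriv a x / a x) / a x * β - κ * (σ x / a x) ^ 2 * β ^ 2 / 2) := by
      conv_lhs => rw [hfe]
      rw [Real.log_mul hJ.ne' (by positivity), Real.log_div hqaT.ne' hqax.ne']
      linarith [Real.log_le_sub_one_of_pos hJ]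
    have hmul := mul_le_mul_of_nonneg_left hlog (mul_pos hfpos hpx).le
    have hfn := hfpos.ne'
    set w₁ := a (T x) / σ (T x) ^ 2
    have e1 : deriv f x / f x * (f x * (q x / a x) * β) = deriv f x * (q x / a x) * β := by
      field_simp
    have e2 : κ / 2 * (f x * (q x / a x) * β) ^ 2 / (f x * q x)
        = f x * (q x / σ x ^ 2) * (κ * (σ x / a x) ^ 2 * β ^ 2 / 2) := by
      field_simp
    have e3 : f x * (q x / σ x ^ 2) * (T' * w₁ / (a x / σ x ^ 2) - 1)
        = f x * (q x / a x) * (w₁ * T' - a x / σ x ^ 2) := by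
      field_simp
    have e4 : f x * (q x / σ x ^ 2) * ((b x - σ x ^ 2 * deriv a x / a x) / a x * β)
        = f x * (a x / σ x ^ 2 * ((b x - σ x ^ 2 * deriv a x / a x) / a x) * (q x / a x)) * β := by
      field_simp
    rw [e1, e2, Pi.mul_apply]
    rw [mul_add, mul_sub _ (_ * β), e3, e4] at hmul
    linarith

theorem exists_cdf {p : ℝ → ℝ} (hp : Continuous p) (hpi : Integrable p) (hp1 : ∫ x, p x = 1) :
    ∃ F : ℝ → ℝ, (∀ x, HasStrictDerivAt F (p x) x) ∧
      Filter.Tendsto F Filter.atBot (nhds 0) ∧ Filter.Tendsto F Filter.atTop (nhds 1) := by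
  have h0 := intervalIntegral.integral_Iic_add_Ioi (b := 0) hpi.integrableOn hpi.integrableOn
  refine ⟨fun x => (∫ t in Set.Iic 0, p t) + ∫ t in (0:ℝ)..x, p t, fun x => ?_, ?_, ?_⟩
  · exact (intervalIntegral.integral_hasStrictDerivAt_right (hp.intervalIntegrable _ _)
      (hp.stronglyMeasurableAtFilter _ _) hp.continuousAt).const_add _
  · have h := intervalIntegral_tendsto_integral_Iic (0:ℝ) hpi.integrableOn Filter.tendsto_id
    convert h.const_sub (∫ t in Set.Iic 0, p t) using 2 with x
    · rw [intervalIntegral.integral_symm, sub_eq_add_neg, id]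
    · simp
  · have h := intervalIntegral_tendsto_integral_Ioi (0:ℝ) hpi.integrableOn Filter.tendsto_id
    have h' := h.const_add (∫ t in Set.Iic 0, p t)
    rwa [h0, hp1] at h'

/-- Monotone transport between two positive continuous probability densities on the line. -/
theorem exists_transport {p r : ℝ → ℝ} (hp : Continuous p) (hr : Continuous r)
    (hpi : Integrable p) (hri : Integrable r) (hp1 : ∫ x, p x = 1) (hr1 : ∫ x, r x = 1)
    (hppos : ∀ x, 0 < p x) (hrpos : ∀ x, 0 < r x) :
    ∃ T T' : ℝ → ℝ, ∀ x, HasDerivAt T (T' x) x ∧ r x = T' x * p (T x) := by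
  obtain ⟨F, hF, hFb, hFt⟩ := exists_cdf hp hpi hp1
  obtain ⟨G, hG, hGb, hGt⟩ := exists_cdf hr hri hr1
  have hFmono : StrictMono F := strictMono_of_deriv_pos fun x => by
    rw [(hF x).hasDerivAt.deriv]; exact hppos x
  have hGmono : StrictMono G := strictMono_of_deriv_pos fun x => by
    rw [(hG x).hasDerivAt.deriv]; exact hrpos x
  have hFc : Continuous F := continuous_iff_continuousAt.2 fun x => (hF x).hasDerivAt.continuousAt
  have hsurj : ∀ x, ∃ t, F t = G x := fun x => by
    have h0 : 0 < G x := (hGmono.monotone.le_of_tendsto hGb (x - 1)).trans_lt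
      (hGmono (sub_one_lt x))
    have h1 : G x < 1 := (hGmono (lt_add_one x)).trans_le
      (hGmono.monotone.ge_of_tendsto hGt (x + 1))
    obtain ⟨u, hu⟩ := (hFb.eventually (gt_mem_nhds h0)).exists
    obtain ⟨v, hv⟩ := (hFt.eventually (lt_mem_nhds h1)).exists
    exact mem_range_of_exists_le_of_exists_ge hFc ⟨u, hu.le⟩ ⟨v, hv.le⟩
  choose T hT using hsurj
  refine ⟨T, fun x => r x / p (T x), fun x => ⟨?_, (div_mul_cancel₀ _ (hppos _).ne').symm⟩⟩
  have hne := (hppos (T x)).ne'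
  have hinv := ((hF (T x)).to_localInverse hne).hasDerivAt
  rw [hT x] at hinv
  have hcomp := HasDerivAt.comp x hinv (hG x).hasDerivAt
  have hev : ∀ᶠ y in nhds x, F ((hF (T x)).localInverse F (p (T x)) (T x) hne (G y)) = G y := by
    have h := HasStrictFDerivAt.eventually_right_inverse
      ((hF (T x)).hasStrictFDerivAt_equiv hne)
    rw [hT x] at h
    exact (hG x).hasDerivAt.continuousAt.eventually h
  refine (hcomp.congr_deriv (div_eq_inv_mul _ _).symm).congr_of_eventuallyEq ?_
  filter_upwards [hev] with y hy
  exact hFmono.injective ((hT y).trans hy.symm)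

theorem exists_lt_of_riccati {Φ Φ' σ p : ℝ → ℝ} {k D R ε : ℝ} (hσ : Continuous σ)
    (hp : Continuous p) (hσpos : ∀ x, 0 < σ x) (hppos : ∀ x, 0 < p x) (hpi : Integrable p)
    (hcomp : ¬ IntegrableOn (fun u => 1 / σ u) (Set.Ioi 0)) (hk : 0 < k) (hD : 0 ≤ D)
    (hε : 0 < ε) (hΦ : ∀ x, HasDerivAt Φ (Φ' x) x)
    (hric : ∀ x, R ≤ x → k * Φ x ^ 2 / (p x * σ x ^ 2) - D * p x ≤ Φ' x) :
    ∃ r, R ≤ r ∧ Φ r < ε := by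
  by_contra! hcon
  have hσi : Continuous fun u => 1 / σ u := continuous_const.div hσ fun x => (hσpos x).ne'
  set C := k + D / ε ^ 2 with hC
  have hCpos : 0 ≤ C := by positivity
  have hbound : ∀ r, R ≤ r → 2 * k * ∫ u in R..r, 1 / σ u ≤ 1 / ε + C * ∫ u, p u := by
    intro r hr
    have hΦpos : ∀ x, R ≤ x → 0 < Φ x := fun x hx => hε.trans_le (hcon x hx)
    have hder : ∀ x ∈ Set.Icc R r, HasDerivAt (fun y => -(Φ y)⁻¹) (Φ' x / Φ x ^ 2) x :=
      fun x hx => ((hΦ x).inv (hΦpos x hx.1).ne').neg.congr_deriv (by ring)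
    have hle : ∀ x ∈ Set.Icc R r, 2 * k * (1 / σ x) - C * p x ≤ Φ' x / Φ x ^ 2 := by
      intro x hx
      have hpos := hΦpos x hx.1
      have h1 := hσpos x
      have h2 := hppos x
      rw [le_div_iff₀ (by positivity)]
      refine le_trans ?_ (hric x hx.1)
      have hamgm : 2 * (1 / σ x) ≤ 1 / (p x * σ x ^ 2) + p x := by
        have : 1 / (p x * σ x ^ 2) + p x - 2 * (1 / σ x)
            = (1 - p x * σ x) ^ 2 / (p x * σ x ^ 2) := by
          field_simp
          ring
        have h3 : 0 ≤ (1 - p x * σ x) ^ 2 / (p x * σ x ^ 2) := by positivity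
        linarith
      have hDle : D * p x ≤ D / ε ^ 2 * p x * Φ x ^ 2 := by
        have : ε ^ 2 ≤ Φ x ^ 2 := pow_le_pow_left₀ hε.le (hcon x hx.1) 2
        calc D * p x = D / ε ^ 2 * p x * ε ^ 2 := by field_simp
          _ ≤ _ := by gcongr
      have := mul_le_mul_of_nonneg_left hamgm (mul_pos hk (pow_pos hpos 2)).le
      calc _ = k * Φ x ^ 2 * (2 * (1 / σ x)) - k * Φ x ^ 2 * p x - D / ε ^ 2 * p x * Φ x ^ 2 := by
            rw [hC]; ring
        _ ≤ k * Φ x ^ 2 * (1 / (p x * σ x ^ 2) + p x) - k * Φ x ^ 2 * p x - D * p x := by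
            linarith
        _ = _ := by ring
    have hint : Continuous fun x => 2 * k * (1 / σ x) - C * p x :=
      (hσi.const_mul _).sub (hp.const_mul _)
    have hftc := intervalIntegral.integral_le_sub_of_hasDeriv_right_of_le hr
      (fun x hx => (hder x hx).continuousAt.continuousWithinAt)
      (fun x hx => (hder x (Set.Ioo_subset_Icc_self hx)).hasDerivWithinAt)
      hint.continuousOn.integrableOn_Icc
      (fun x hx => hle x (Set.Ioo_subset_Icc_self hx))
    rw [intervalIntegral.integral_sub ((hσi.const_mul _).intervalIntegrable _ _)
      ((hp.const_mul _).intervalIntegrable _ _), intervalIntegral.integral_const_mul,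
      intervalIntegral.integral_const_mul] at hftc
    have hple : ∫ u in R..r, p u ≤ ∫ u, p u := by
      rw [intervalIntegral.integral_of_le hr]
      exact setIntegral_le_integral hpi (Filter.Eventually.of_forall fun x => (hppos x).le)
    have h1 := mul_le_mul_of_nonneg_left hple hCpos
    have h2 : (Φ R)⁻¹ ≤ 1 / ε := by
      rw [one_div]; exact inv_anti₀ hε (hcon R le_rfl)
    have h3 : 0 < (Φ r)⁻¹ := inv_pos.2 (hΦpos r hr)
    linarith
  have hIoi : IntegrableOn (fun u => 1 / σ u) (Set.Ioi R) := by
    refine integrableOn_Ioi_of_intervalIntegral_norm_bounded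
      ((1 / ε + C * ∫ u, p u) / (2 * k)) R
      (fun i => hσi.continuousOn.integrableOn_Icc.mono_set Set.Ioc_subset_Icc_self)
      Filter.tendsto_id ?_
    filter_upwards [Filter.eventually_ge_atTop R] with r hr
    have : ∀ u, ‖1 / σ u‖ = 1 / σ u := fun u =>
      Real.norm_of_nonneg (one_div_pos.2 (hσpos u)).le
    simp only [this, id]
    rw [le_div_iff₀ (by positivity), mul_comm]
    exact hbound r hr
  refine hcomp (((hσi.continuousOn.integrableOn_Icc (a := 0) (b := R)).union hIoi).mono_set ?_)
  intro u hu
  rcases le_or_gt u R with h | h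
  · exact Or.inl ⟨le_of_lt hu, h⟩
  · exact Or.inr h

theorem hasDerivAt_of_eq_or_eq {u v w T : ℝ → ℝ} {u' v' x : ℝ} (hT : ContinuousAt T x)
    (hu : x ≤ T x → HasDerivAt u u' x) (hv : T x ≤ x → HasDerivAt v v' x)
    (huv : T x = x → u x = v x ∧ u' = v')
    (hwu : ∀ y, y ≤ T y → w y = u y) (hwv : ∀ y, T y < y → w y = v y) :
    HasDerivAt w (if x ≤ T x then u' else v') x := by
  rcases lt_trichotomy x (T x) with h | h | h
  · rw [if_pos h.le]
    refine (hu h.le).congr_of_eventuallyEq ?_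
    filter_upwards [continuousAt_id.eventually_lt hT h] with y hy
    exact hwu y hy.le
  · obtain ⟨e, e'⟩ := huv h.symm
    rw [if_pos h.le]
    have h1 : HasDerivWithinAt w u' {y | y ≤ T y} x :=
      (hu h.le).hasDerivWithinAt.congr (fun y hy => hwu y hy) (hwu x h.le)
    have h2 : HasDerivWithinAt w u' {y | T y < y} x :=
      (e' ▸ (hv h.symm.le)).hasDerivWithinAt.congr (fun y hy => hwv y hy)
        ((hwu x h.le).trans e)
    have := h1.union h2
    rwa [show {y | y ≤ T y} ∪ {y | T y < y} = Set.univ from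
      Set.eq_univ_of_forall fun y => le_or_gt y (T y), hasDerivWithinAt_univ] at this
  · rw [if_neg h.not_ge]
    refine (hv h.le).congr_of_eventuallyEq ?_
    filter_upwards [hT.eventually_lt continuousAt_id h] with y hy
    exact hwv y hy

theorem exists_antideriv {g : ℝ → ℝ} (hg : Continuous g) : ∃ S : ℝ → ℝ, ∀ x, HasDerivAt S (g x) x :=
  ⟨fun x => ∫ t in (0:ℝ)..x, g t, fun _ => intervalIntegral.integral_hasDerivAt_right
    (hg.intervalIntegrable _ _) (hg.stronglyMeasurableAtFilter _ _) hg.continuousAt⟩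

/-- A flux `Φ` realising the local form of the entropy inequality for a probability density `f`. -/
theorem exists_flux {σ b a a₂ q f : ℝ → ℝ} {ρ ρ' κ : ℝ}
    (hσ : ContDiff ℝ (⊤ : ℕ∞) σ) (hb : ContDiff ℝ (⊤ : ℕ∞) b)
    (ha : ContDiff ℝ (⊤ : ℕ∞) a) (ha₂ : ContDiff ℝ (⊤ : ℕ∞) a₂)
    (hσpos : ∀ x, 0 < σ x) (hapos : ∀ x, 0 < a x) (ha₂pos : ∀ x, 0 < a₂ x)
    (hqpos : ∀ x, 0 < q x) (hq : ∀ x, HasDerivAt q (b x / σ x ^ 2 * q x) x)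
    (hmono : Monotone (fun x => σ x / a x)) (hanti : Antitone (fun x => σ x / a₂ x))
    (hκ : 0 ≤ κ) (hκρ : κ ≤ ρ) (hκρ' : κ ≤ ρ')
    (hVa : ∀ x, ρ ≤ potV σ b a x) (hVa₂ : ∀ x, ρ' ≤ potV σ b a₂ x)
    (hpi : Integrable fun x => q x / σ x ^ 2) (hp1 : ∫ x, q x / σ x ^ 2 = 1)
    (hf : Differentiable ℝ f) (hfpos : ∀ x, 0 < f x)
    (hfi : Integrable fun x => f x * (q x / σ x ^ 2)) (hf1 : ∫ x, f x * (q x / σ x ^ 2) = 1) :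
    ∃ Φ Φ' : ℝ → ℝ, ∀ x, HasDerivAt Φ (Φ' x) x ∧
      f x * (q x / σ x ^ 2) * Real.log (f x) + deriv f x / f x * Φ x
        + κ / 2 * Φ x ^ 2 / (f x * q x) ≤ Φ' x := by
  have hqc : Continuous q := continuous_iff_continuousAt.2 fun x => (hq x).continuousAt
  have hσc := hσ.continuous
  have hσ2 : ∀ x, σ x ^ 2 ≠ 0 := fun x => (pow_pos (hσpos x) 2).ne'
  have hpc : Continuous fun x => q x / σ x ^ 2 := hqc.div (hσc.pow 2) hσ2
  have hppos : ∀ x, 0 < q x / σ x ^ 2 := fun x => div_pos (hqpos x) (pow_pos (hσpos x) 2)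
  obtain ⟨T, T', hT⟩ := exists_transport hpc (hf.continuous.mul hpc) hpi hfi hp1 hf1 hppos
    (fun x => mul_pos (hfpos x) (hppos x))
  obtain ⟨S, hS⟩ := exists_antideriv (ha.continuous.div (hσc.pow 2) hσ2)
  obtain ⟨S₂, hS₂⟩ := exists_antideriv (ha₂.continuous.div (hσc.pow 2) hσ2)
  set u : ℝ → ℝ := fun y => f y * (q y / a y) * (S (T y) - S y) with hu
  set v : ℝ → ℝ := fun y => f y * (q y / a₂ y) * (S₂ (T y) - S₂ y) with hv
  have h₁ : ∀ x, ∃ D, x ≤ T x → HasDerivAt u D x ∧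
      (T x = x → D = f x * (q x / σ x ^ 2) * (T' x - 1)) ∧
      f x * (q x / σ x ^ 2) * Real.log (f x) + deriv f x / f x * u x
        + κ / 2 * u x ^ 2 / (f x * q x) ≤ D := fun x => by
    by_cases h : x ≤ T x
    · obtain ⟨D, hD⟩ := flux_hasDerivAt_and_le hσ hb ha hσpos hapos hqpos hq hS hκρ hκ hVa (hf x)
        (hfpos x) (hT x).1 (hT x).2
        (fun s hs => hmono (by rw [Set.uIcc_of_le h] at hs; exact hs.1))
      exact ⟨D, fun _ => hD⟩
    · exact ⟨0, fun h' => absurd h' h⟩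
  have h₂ : ∀ x, ∃ D, T x ≤ x → HasDerivAt v D x ∧
      (T x = x → D = f x * (q x / σ x ^ 2) * (T' x - 1)) ∧
      f x * (q x / σ x ^ 2) * Real.log (f x) + deriv f x / f x * v x
        + κ / 2 * v x ^ 2 / (f x * q x) ≤ D := fun x => by
    by_cases h : T x ≤ x
    · obtain ⟨D, hD⟩ := flux_hasDerivAt_and_le hσ hb ha₂ hσpos ha₂pos hqpos hq hS₂ hκρ' hκ hVa₂
        (hf x) (hfpos x) (hT x).1 (hT x).2
        (fun s hs => hanti (by rw [Set.uIcc_of_ge h] at hs; exact hs.2))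
      exact ⟨D, fun _ => hD⟩
    · exact ⟨0, fun h' => absurd h' h⟩
  choose u' hu' using h₁
  choose v' hv' using h₂
  refine ⟨fun y => if y ≤ T y then u y else v y, fun x => if x ≤ T x then u' x else v' x,
    fun x => ⟨?_, ?_⟩⟩
  · exact hasDerivAt_of_eq_or_eq (T := T) (hT x).1.continuousAt (fun h => (hu' x h).1)
      (fun h => (hv' x h).1)
      (fun h => ⟨by simp [hu, hv, h],
        ((hu' x h.ge).2.1 h).trans ((hv' x h.le).2.1 h).symm⟩)
      (fun y h => if_pos h) (fun y h => if_neg h.not_ge)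
  · by_cases h : x ≤ T x
    · simp only [if_pos h]
      exact (hu' x h).2.2
    · simp only [if_neg h]
      exact (hv' x (not_le.1 h).le).2.2

theorem integral_nonpos_of_flux {Φ Φ' φ : ℝ → ℝ} (hφ : Continuous φ) (hφi : Integrable φ)
    (hΦ : ∀ x, HasDerivAt Φ (Φ' x) x) (hle : ∀ x, φ x ≤ Φ' x)
    (htop : ∀ R ε : ℝ, 0 < ε → ∃ r, R ≤ r ∧ Φ r < ε)
    (hbot : ∀ R ε : ℝ, 0 < ε → ∃ r, R ≤ r ∧ -Φ (-r) < ε) : ∫ x, φ x ≤ 0 := by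
  choose r hr hΦr using fun n : ℕ => htop n _ (Nat.one_div_pos_of_nat (α := ℝ) (n := n))
  choose s hs hΦs using fun n : ℕ => hbot n _ (Nat.one_div_pos_of_nat (α := ℝ) (n := n))
  have hlim := intervalIntegral_tendsto_integral hφi
    (Filter.tendsto_neg_atTop_atBot.comp
      (Filter.tendsto_atTop_mono hs tendsto_natCast_atTop_atTop))
    (Filter.tendsto_atTop_mono hr tendsto_natCast_atTop_atTop)
  have h0 := (tendsto_one_div_add_atTop_nhds_zero_nat (𝕜 := ℝ)).add
    (tendsto_one_div_add_atTop_nhds_zero_nat (𝕜 := ℝ))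
  rw [add_zero] at h0
  refine le_of_tendsto_of_tendsto' hlim h0 fun n => ?_
  have hn : (0:ℝ) ≤ n := n.cast_nonneg
  have := intervalIntegral.integral_le_sub_of_hasDeriv_right_of_le
    (show -s n ≤ r n by linarith [hs n, hr n])
    (fun x _ => (hΦ x).continuousAt.continuousWithinAt)
    (fun x _ => (hΦ x).hasDerivWithinAt)
    hφ.continuousOn.integrableOn_Icc (fun x _ => hle x)
  simp only [Function.comp_apply]
  linarith [hΦr n, hΦs n]

/-- The entropy inequality for a probability density `f`, in terms of the flux `q = e^{-U}`. -/
theorem entropy_le_of_integral_eq_one {σ b a a₂ q f : ℝ → ℝ} {ρ ρ' κ R C : ℝ}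
    (hσ : ContDiff ℝ (⊤ : ℕ∞) σ) (hb : ContDiff ℝ (⊤ : ℕ∞) b)
    (ha : ContDiff ℝ (⊤ : ℕ∞) a) (ha₂ : ContDiff ℝ (⊤ : ℕ∞) a₂)
    (hσpos : ∀ x, 0 < σ x) (hapos : ∀ x, 0 < a x) (ha₂pos : ∀ x, 0 < a₂ x)
    (hcomp₁ : ¬ IntegrableOn (fun u => 1 / σ u) (Set.Ioi 0))
    (hcomp₂ : ¬ IntegrableOn (fun u => 1 / σ u) (Set.Iio 0))
    (hqpos : ∀ x, 0 < q x) (hq : ∀ x, HasDerivAt q (b x / σ x ^ 2 * q x) x)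
    (hmono : Monotone (fun x => σ x / a x)) (hanti : Antitone (fun x => σ x / a₂ x))
    (hκ : 0 < κ) (hκρ : κ ≤ ρ) (hκρ' : κ ≤ ρ')
    (hVa : ∀ x, ρ ≤ potV σ b a x) (hVa₂ : ∀ x, ρ' ≤ potV σ b a₂ x)
    (hpi : Integrable fun x => q x / σ x ^ 2) (hp1 : ∫ x, q x / σ x ^ 2 = 1)
    (hf : Differentiable ℝ f) (hf' : Continuous (deriv f)) (hfpos : ∀ x, 0 < f x)
    (hfC : ∀ x, f x ≤ C) (hfR : ∀ x, R ≤ |x| → deriv f x = 0)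
    (hfi : Integrable fun x => f x * (q x / σ x ^ 2)) (hf1 : ∫ x, f x * (q x / σ x ^ 2) = 1)
    (hent : Integrable fun x => f x * (q x / σ x ^ 2) * Real.log (f x))
    (hfis : Integrable fun x => q x * deriv f x ^ 2 / f x) :
    2 * κ * ∫ x, f x * (q x / σ x ^ 2) * Real.log (f x) ≤ ∫ x, q x * deriv f x ^ 2 / f x := by
  have hqc : Continuous q := continuous_iff_continuousAt.2 fun x => (hq x).continuousAt
  have hσc := hσ.continuous
  have hσ2 : ∀ x, σ x ^ 2 ≠ 0 := fun x => (pow_pos (hσpos x) 2).ne'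
  have hpc : Continuous fun x => q x / σ x ^ 2 := hqc.div (hσc.pow 2) hσ2
  have hppos : ∀ x, 0 < q x / σ x ^ 2 := fun x => div_pos (hqpos x) (pow_pos (hσpos x) 2)
  have hfc := hf.continuous
  have hfn : ∀ x, f x ≠ 0 := fun x => (hfpos x).ne'
  have hCpos : 0 < C := (hfpos 0).trans_le (hfC 0)
  obtain ⟨Φ, Φ', hΦ⟩ := exists_flux hσ hb ha ha₂ hσpos hapos ha₂pos hqpos hq hmono hanti hκ.le
    hκρ hκρ' hVa hVa₂ hpi hp1 hf hfpos hfi hf1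
  have hric : ∀ x, R ≤ |x| →
      κ / 2 / C * Φ x ^ 2 / (q x / σ x ^ 2 * σ x ^ 2) - 1 * (q x / σ x ^ 2) ≤ Φ' x := by
    intro x hx
    refine le_trans ?_ (hΦ x).2
    have hlog : -1 ≤ f x * Real.log (f x) := by
      have h := mul_le_mul_of_nonneg_left (Real.one_sub_inv_le_log_of_pos (hfpos x)) (hfpos x).le
      rw [mul_sub, mul_inv_cancel₀ (hfn x)] at h
      linarith [hfpos x]
    have h1 := mul_le_mul_of_nonneg_right hlog (hppos x).le
    have h2 : κ / 2 / C * Φ x ^ 2 / (q x / σ x ^ 2 * σ x ^ 2)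
        ≤ κ / 2 * Φ x ^ 2 / (f x * q x) := by
      rw [div_mul_cancel₀ _ (hσ2 x)]
      have h3 := hqpos x
      have h4 := hfpos x
      calc κ / 2 / C * Φ x ^ 2 / q x = κ / 2 * Φ x ^ 2 / (C * q x) := by field_simp
        _ ≤ _ := by
          gcongr
          exact hfC x
    rw [hfR x hx, zero_div, zero_mul]
    linarith
  have key : ∫ x, (f x * (q x / σ x ^ 2) * Real.log (f x)
      - (2 * κ)⁻¹ * (q x * deriv f x ^ 2 / f x)) ≤ 0 := by
    refine integral_nonpos_of_flux (Φ := Φ) (Φ' := Φ') ?_ (hent.sub (hfis.const_mul _))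
      (fun x => (hΦ x).1) (fun x => ?_) (fun R' ε hε => ?_) (fun R' ε hε => ?_)
    · exact ((hfc.mul hpc).mul (hfc.log hfn)).sub
        (((hqc.mul (hf'.pow 2)).div hfc hfn).const_mul _)
    · refine le_trans ?_ (hΦ x).2
      have h3 := hqpos x
      have h4 := hfpos x
      have : deriv f x / f x * Φ x + κ / 2 * Φ x ^ 2 / (f x * q x)
          + (2 * κ)⁻¹ * (q x * deriv f x ^ 2 / f x)
          = (κ * Φ x + q x * deriv f x) ^ 2 / (2 * κ * f x * q x) := by
        field_simp
        ring
      have h5 : 0 ≤ (κ * Φ x + q x * deriv f x) ^ 2 / (2 * κ * f x * q x) := by positivity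
      linarith
    · obtain ⟨r, hr, h⟩ := exists_lt_of_riccati (R := max R R') hσc hpc hσpos hppos hpi hcomp₁
        (by positivity : 0 < κ / 2 / C) zero_le_one hε (fun x => (hΦ x).1)
        (fun x hx => hric x (((le_max_left _ _).trans hx).trans (le_abs_self x)))
      exact ⟨r, (le_max_right _ _).trans hr, h⟩
    · have hcomp : ¬ IntegrableOn (fun u => 1 / σ (-u)) (Set.Ioi 0) := fun h => hcomp₂ (by
        have := h.comp_neg
        simpa using this)
      obtain ⟨r, hr, h⟩ := exists_lt_of_riccati (R := max R R') (Φ := fun x => -Φ (-x))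
        (Φ' := fun x => Φ' (-x)) (hσc.comp continuous_neg) (hpc.comp continuous_neg)
        (fun x => hσpos (-x)) (fun x => hppos (-x)) hpi.comp_neg hcomp
        (by positivity : 0 < κ / 2 / C) zero_le_one hε
        (fun x => by
          have := ((hΦ (-x)).1.comp x (hasDerivAt_neg x)).neg
          exact this.congr_deriv (by ring))
        (fun x hx => by
          have := hric (-x) (by
            rw [abs_neg]
            exact ((le_max_left _ _).trans hx).trans (le_abs_self x))
          simpa only [neg_sq, Function.comp_apply] using this)
      exact ⟨r, (le_max_right _ _).trans hr, h⟩
  rw [integral_sub hent (hfis.const_mul _), integral_const_mul, sub_nonpos,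
    ← div_eq_inv_mul, le_div_iff₀ (by positivity)] at key
  linarith

theorem exists_range_eq_image_Icc {f : ℝ → ℝ} (hf : Differentiable ℝ f)
    (hf' : HasCompactSupport (deriv f)) :
    ∃ R, (∀ x, R ≤ |x| → deriv f x = 0) ∧ Set.range f = f '' Set.Icc (-R) R := by
  obtain ⟨R, hR, h⟩ := hf'.exists_pos_le_norm
  refine ⟨R, fun x hx => h x hx, Set.Subset.antisymm ?_ (Set.image_subset_range _ _)⟩
  rintro _ ⟨x, rfl⟩
  rcases lt_or_ge x (-R) with h1 | h1
  · refine ⟨-R, ⟨le_rfl, by linarith⟩, ?_⟩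
    refine (convex_Iic (-R)).is_const_of_fderivWithin_eq_zero (𝕜 := ℝ) hf.differentiableOn
      (fun y hy => ?_) (Set.mem_Iic.2 le_rfl) (Set.mem_Iic.2 h1.le)
    have hy' : deriv f y = 0 := h y (by
      rw [Real.norm_eq_abs]; exact (le_neg.1 hy).trans (neg_le_abs y))
    rw [(hf y).fderivWithin (uniqueDiffOn_Iic (-R) y hy)]
    ext
    simpa using hy'
  · rcases le_or_gt x R with h2 | h2
    · exact ⟨x, ⟨h1, h2⟩, rfl⟩
    · refine ⟨R, ⟨by linarith, le_rfl⟩, ?_⟩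
      refine (convex_Ici R).is_const_of_fderivWithin_eq_zero (𝕜 := ℝ) hf.differentiableOn
        (fun y hy => ?_) (Set.mem_Ici.2 le_rfl) (Set.mem_Ici.2 h2.le)
      have hy' : deriv f y = 0 := h y (le_trans hy (le_abs_self y))
      rw [(hf y).fderivWithin (uniqueDiffOn_Ici R y hy)]
      ext
      simpa using hy'

theorem not_integrableOn_of_lintegral_eq_top {g : ℝ → ℝ} {s : Set ℝ} (hg : ∀ x, 0 ≤ g x)
    (h : ∫⁻ u in s, ENNReal.ofReal (g u) = ⊤) : ¬ IntegrableOn g s := fun hi =>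
  ((hasFiniteIntegral_iff_ofReal (Filter.Eventually.of_forall hg)).1 hi.hasFiniteIntegral).ne h

/-- Log-Sobolev criterion: if there are smooth positive `a, a₂` comparable to `σ` with
`σ/a` increasing, `σ/a₂` decreasing, `V_a ≥ ρ > 0` and `V_a₂ ≥ ρ̃ > 0`, then the
logarithmic Sobolev inequality `2 min(ρ,ρ̃) Ent_μ(f) ≤ ∫ σ² (f')²/f dμ` holds for every
smooth positive `f` with compactly supported derivative. -/
theorem log_sobolev_criterion
    (σ b a a₂ : ℝ → ℝ) (U0 ρ ρ' m M : ℝ)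
    (hσ : ContDiff ℝ (⊤ : ℕ∞) σ) (hb : ContDiff ℝ (⊤ : ℕ∞) b)
    (ha : ContDiff ℝ (⊤ : ℕ∞) a) (ha₂ : ContDiff ℝ (⊤ : ℕ∞) a₂)
    (hσpos : ∀ x, 0 < σ x) (hapos : ∀ x, 0 < a x) (ha₂pos : ∀ x, 0 < a₂ x)
    (hcomp₁ : ∫⁻ u in Set.Ioi (0:ℝ), ENNReal.ofReal (1 / σ u) = ⊤)
    (hcomp₂ : ∫⁻ u in Set.Iio (0:ℝ), ENNReal.ofReal (1 / σ u) = ⊤)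
    (hprob : IsProbabilityMeasure (muMeas σ b U0))
    (hm : 0 < m) (hmM : m ≤ M)
    (hma : ∀ x, m * σ x ≤ a x) (haM : ∀ x, a x ≤ M * σ x)
    (hma₂ : ∀ x, m * σ x ≤ a₂ x) (ha₂M : ∀ x, a₂ x ≤ M * σ x)
    (hmono : Monotone (fun x => σ x / a x))
    (hanti : Antitone (fun x => σ x / a₂ x))
    (hρ : 0 < ρ) (hρ' : 0 < ρ')
    (hVa : ∀ x, ρ ≤ potV σ b a x) (hVa₂ : ∀ x, ρ' ≤ potV σ b a₂ x) :
    ∀ f : ℝ → ℝ, ContDiff ℝ (⊤ : ℕ∞) f → (∀ x, 0 < f x) → HasCompactSupport (deriv f) →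
      2 * min ρ ρ' *
          ((∫ x, f x * Real.log (f x) ∂(muMeas σ b U0))
            - (∫ x, f x ∂(muMeas σ b U0)) * Real.log (∫ x, f x ∂(muMeas σ b U0)))
        ≤ ∫ x, σ x ^ 2 * deriv f x ^ 2 / f x ∂(muMeas σ b U0) := by
  intro f hf hfpos hfcs
  set q : ℝ → ℝ := fun x => Real.exp (-(Upot σ b U0 x)) with hqdef
  have hσc := hσ.continuous
  have hσ2 : ∀ x, σ x ^ 2 ≠ 0 := fun x => (pow_pos (hσpos x) 2).ne'
  have hqpos : ∀ x, 0 < q x := fun x => Real.exp_pos _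
  have hq : ∀ x, HasDerivAt q (b x / σ x ^ 2 * q x) x := fun x => by
    have hc : Continuous fun u => b u / σ u ^ 2 := hb.continuous.div (hσc.pow 2) hσ2
    have h := (intervalIntegral.integral_hasDerivAt_right (hc.intervalIntegrable 0 x)
      (hc.stronglyMeasurableAtFilter _ _) hc.continuousAt).const_sub U0
    exact h.neg.exp.congr_deriv (by simp only [hqdef, Upot, neg_neg, Pi.neg_apply]; ring)
  have hqc : Continuous q := continuous_iff_continuousAt.2 fun x => (hq x).continuousAt
  have hpc : Continuous fun x => q x / σ x ^ 2 := hqc.div (hσc.pow 2) hσ2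
  have hppos : ∀ x, 0 < q x / σ x ^ 2 := fun x => div_pos (hqpos x) (pow_pos (hσpos x) 2)
  have hμ : ∀ g : ℝ → ℝ, ∫ x, g x ∂(muMeas σ b U0) = ∫ x, g x * (q x / σ x ^ 2) := fun g => by
    rw [muMeas, integral_withDensity_eq_integral_toReal_smul hpc.measurable.ennreal_ofReal
      (Filter.Eventually.of_forall fun x => ENNReal.ofReal_lt_top)]
    refine integral_congr_ae (Filter.Eventually.of_forall fun x => ?_)
    simp only [smul_eq_mul]
    rw [ENNReal.toReal_ofReal (hppos x).le, mul_comm]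
  have hlint : ∫⁻ x, ENNReal.ofReal (q x / σ x ^ 2) = 1 := by
    have h := hprob.measure_univ
    rwa [muMeas, withDensity_apply _ MeasurableSet.univ, Measure.restrict_univ] at h
  have hpi : Integrable fun x => q x / σ x ^ 2 := ⟨hpc.aestronglyMeasurable, by
    rw [hasFiniteIntegral_iff_ofReal (Filter.Eventually.of_forall fun x => (hppos x).le)]
    exact hlint ▸ ENNReal.one_lt_top⟩
  have hp1 : ∫ x, q x / σ x ^ 2 = 1 := by
    rw [integral_eq_lintegral_of_nonneg_ae (Filter.Eventually.of_forall fun x => (hppos x).le)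
      hpc.aestronglyMeasurable]
    exact congrArg ENNReal.toReal hlint
  have hfd : Differentiable ℝ f := hf.differentiable (by simp)
  have hfc := hf.continuous
  have hf' : Continuous (deriv f) := hf.continuous_deriv (by simp)
  obtain ⟨R, hR, hrange⟩ := exists_range_eq_image_Icc hfd hfcs
  have hcomp : IsCompact (Set.range f) := hrange ▸ isCompact_Icc.image hfc
  have hbdd : ∀ g : ℝ → ℝ, Continuous g → Integrable fun x => g (f x) * (q x / σ x ^ 2) :=
    fun g hg => by
      obtain ⟨K, hK⟩ := hcomp.exists_bound_of_continuousOn hg.continuousOn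
      exact hpi.bdd_mul (hg.comp hfc).aestronglyMeasurable
        (Filter.Eventually.of_forall fun x => hK _ ⟨x, rfl⟩)
  obtain ⟨C, hC⟩ := hcomp.bddAbove
  have hfi : Integrable fun x => f x * (q x / σ x ^ 2) := hbdd _ continuous_id
  have hlogi : Integrable fun x => f x * Real.log (f x) * (q x / σ x ^ 2) :=
    hbdd _ Real.continuous_mul_log
  have hfis : Integrable fun x => q x * deriv f x ^ 2 / f x := by
    refine Continuous.integrable_of_hasCompactSupport
      ((hqc.mul (hf'.pow 2)).div hfc fun x => (hfpos x).ne') ?_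
    refine hfcs.mono fun x hx => ?_
    contrapose! hx
    simp only [Function.mem_support, not_not] at hx ⊢
    simp [hx]
  rw [hμ, hμ, hμ]
  set Z := ∫ x, f x * (q x / σ x ^ 2) with hZ
  have hZpos : 0 < Z := by
    refine (integral_pos_iff_support_of_nonneg
      (fun x => (mul_pos (hfpos x) (hppos x)).le) hfi).2 ?_
    rw [show Function.support (fun x => f x * (q x / σ x ^ 2)) = Set.univ from
      Set.eq_univ_of_forall fun x => (mul_pos (hfpos x) (hppos x)).ne']
    simp
  have hZn := hZpos.ne'
  have hfn : ∀ x, f x ≠ 0 := fun x => (hfpos x).ne'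
  have e₁ : ∀ x, f x / Z * (q x / σ x ^ 2) * Real.log (f x / Z)
      = Z⁻¹ * (f x * Real.log (f x) * (q x / σ x ^ 2))
        - Z⁻¹ * Real.log Z * (f x * (q x / σ x ^ 2)) := fun x => by
    rw [Real.log_div (hfn x) hZn]
    ring
  have hd : deriv (fun x => f x / Z) = fun x => deriv f x / Z := by
    ext x
    exact deriv_div_const Z
  have e₂ : ∀ x, q x * deriv (fun x => f x / Z) x ^ 2 / (f x / Z)
      = Z⁻¹ * (q x * deriv f x ^ 2 / f x) := fun x => by
    have := hfn x
    rw [hd]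
    field_simp
  have e₃ : ∀ x, f x / Z * (q x / σ x ^ 2) = Z⁻¹ * (f x * (q x / σ x ^ 2)) := fun x => by ring
  have main := entropy_le_of_integral_eq_one (f := fun x => f x / Z) (R := R) (C := C / Z)
    hσ hb ha ha₂ hσpos hapos ha₂pos
    (not_integrableOn_of_lintegral_eq_top (fun x => (one_div_pos.2 (hσpos x)).le) hcomp₁)
    (not_integrableOn_of_lintegral_eq_top (fun x => (one_div_pos.2 (hσpos x)).le) hcomp₂)
    hqpos hq hmono hanti (lt_min hρ hρ') (min_le_left _ _) (min_le_right _ _) hVa hVa₂ hpi hp1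
    (hfd.div_const Z) (hd ▸ hf'.div_const Z) (fun x => div_pos (hfpos x) hZpos)
    (fun x => div_le_div_of_nonneg_right (hC ⟨x, rfl⟩) hZpos.le)
    (fun x hx => by rw [hd]; simp [hR x hx])
    (by simpa only [e₃] using hfi.const_mul Z⁻¹)
    (by simp only [e₃]; rw [integral_const_mul, ← hZ, inv_mul_cancel₀ hZn])
    (by simp only [e₁]; exact (hlogi.const_mul _).sub (hfi.const_mul _))
    (by simpa only [e₂] using hfis.const_mul Z⁻¹)
  simp only [e₁, e₂] at main
  rw [integral_sub (hlogi.const_mul _) (hfi.const_mul _), integral_const_mul, integral_const_mul,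
    integral_const_mul, ← hZ] at main
  have e₄ : ∫ x, σ x ^ 2 * deriv f x ^ 2 / f x * (q x / σ x ^ 2)
      = ∫ x, q x * deriv f x ^ 2 / f x := by
    refine integral_congr_ae (Filter.Eventually.of_forall fun x => ?_)
    have h1 := hσpos x
    have h2 := hfpos x
    simp only
    field_simp
  rw [e₄]
  have := mul_le_mul_of_nonneg_left main hZpos.le
  rw [mul_inv_cancel_left₀ hZn] at this
  refine le_trans (le_of_eq ?_) this
  field_simp
end
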